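/- (Discretized variational estimate leading to contradiction) Let (aⱼ) be a real sequence with |aⱼ| ≤ 1 and (n_k) a sequence of positive integers with n_{k+1} > n_k⁸. With M_n(a)(j) = (1/n) Σ_{l=0}^{n} a_{l+j}, there is an absolute constant C such that for all J, K ∈ ℕ: Σ_{j=1}^{J} Σ_{k=1}^{K} |sup_{n_k ≤ n < n_{k+1}} M_n(a)(j) − M_{n_k}(a)(j)|² ≤ C Σ_{j=1}^{J + n_{K+1}} |aⱼ|². -/

import Mathlib

open Filter Topology

namespace White

def Meas (B : ℕ) (φ : ℕ → ℝ) : Prop := ∀ x, φ x = φ (B * (x / B))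

noncomputable def avg (B : ℕ) (f : ℕ → ℝ) (x : ℕ) : ℝ :=
  (∑ y ∈ Finset.range B, f (B * (x / B) + y)) / B

noncomputable def A (m : ℕ) (f : ℕ → ℝ) (x : ℕ) : ℝ :=
  (∑ l ∈ Finset.range m, f (x + l)) / m

lemma sum_mul (B Q : ℕ) (g : ℕ → ℝ) :
    ∑ x ∈ Finset.range (B * Q), g x
      = ∑ q ∈ Finset.range Q, ∑ r ∈ Finset.range B, g (B * q + r) := by
  induction Q with
  | zero => simp
  | succ Q ih => rw [Nat.mul_succ, Finset.sum_range_add, Finset.sum_range_succ, ih]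

lemma div_block {B q r : ℕ} (hr : r < B) : (B * q + r) / B = q := by
  rw [Nat.mul_add_div (by omega), Nat.div_eq_of_lt hr, add_zero]

lemma Meas.block {B q r : ℕ} {φ : ℕ → ℝ} (h : Meas B φ) (hr : r < B) :
    φ (B * q + r) = φ (B * q) := by
  rw [h (B * q + r), div_block hr]

lemma avg_block {B q r : ℕ} (f : ℕ → ℝ) (hr : r < B) :
    avg B f (B * q + r) = (∑ y ∈ Finset.range B, f (B * q + y)) / B := by
  unfold avg; rw [div_block hr]

lemma sum_block {B q : ℕ} (hB : 0 < B) (f : ℕ → ℝ) :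
    ∑ r ∈ Finset.range B, avg B f (B * q + r) = ∑ r ∈ Finset.range B, f (B * q + r) := by
  rw [Finset.sum_congr rfl (fun r hr => avg_block f (Finset.mem_range.1 hr))]
  have : (B : ℝ) ≠ 0 := by positivity
  simp only [Finset.sum_const, Finset.card_range, nsmul_eq_mul]
  field_simp

lemma adjoint {B : ℕ} (hB : 0 < B) (Q : ℕ) (φ f : ℕ → ℝ) (hφ : Meas B φ) :
    ∑ x ∈ Finset.range (B * Q), φ x * avg B f x = ∑ x ∈ Finset.range (B * Q), φ x * f x := by
  rw [sum_mul, sum_mul]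
  refine Finset.sum_congr rfl fun q _ => ?_
  have key : ∀ ψ : ℕ → ℝ, ∑ r ∈ Finset.range B, φ (B * q + r) * ψ (B * q + r)
      = φ (B * q) * ∑ r ∈ Finset.range B, ψ (B * q + r) := by
    intro ψ
    rw [Finset.mul_sum]
    exact Finset.sum_congr rfl fun r hr => by rw [hφ.block (Finset.mem_range.1 hr)]
  rw [key, key, sum_block hB]

lemma meas_avg {B : ℕ} (hB : 0 < B) (f : ℕ → ℝ) : Meas B (avg B f) := by
  intro x
  unfold avg
  rw [Nat.mul_div_cancel_left _ hB]

lemma Meas.mono {B c : ℕ} (hB : 0 < B) {φ : ℕ → ℝ} (h : Meas (B * c) φ) : Meas B φ := by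
  intro x
  rw [h x, h (B * (x / B)), ← Nat.div_div_eq_div_mul, ← Nat.div_div_eq_div_mul,
    Nat.mul_div_cancel_left _ hB]

lemma avg_tower {B : ℕ} (hB : 0 < B) (c : ℕ) (f : ℕ → ℝ) :
    avg (B * c) (avg B f) = avg (B * c) f := by
  funext x
  unfold avg
  congr 1
  change ∑ y ∈ Finset.range (B * c), avg B f (B * c * (x / (B * c)) + y) = _
  rw [sum_mul, sum_mul]
  refine Finset.sum_congr rfl fun q _ => ?_
  simp only [← add_assoc, mul_assoc, ← mul_add]
  exact sum_block hB f

lemma avg_of_meas {B : ℕ} (hB : 0 < B) (f : ℕ → ℝ) (h : Meas B f) : avg B f = f := by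
  funext x
  unfold avg
  rw [Finset.sum_congr rfl (fun r hr => by rw [h.block (Finset.mem_range.1 hr)]), h x]
  have : (B : ℝ) ≠ 0 := by positivity
  simp; field_simp

lemma avg_sub (B : ℕ) (f g : ℕ → ℝ) (x : ℕ) :
    avg B (fun y => f y - g y) x = avg B f x - avg B g x := by
  unfold avg; rw [Finset.sum_sub_distrib, sub_div]

lemma avg_abs (B : ℕ) (f : ℕ → ℝ) (x : ℕ) : |avg B f x| ≤ avg B (fun y => |f y|) x := by
  unfold avg
  rw [abs_div, Nat.abs_cast]
  gcongr
  exact Finset.abs_sum_le_sum_abs _ _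

lemma avg_zero {B Q : ℕ} (hB : 0 < B) (f : ℕ → ℝ) (hf : ∀ x, B * Q ≤ x → f x = 0) (x : ℕ)
    (hx : B * Q ≤ x) : avg B f x = 0 := by
  unfold avg
  rw [Finset.sum_eq_zero, zero_div]
  intro y _
  apply hf
  have : Q ≤ x / B := (Nat.le_div_iff_mul_le hB).2 (by rw [mul_comm]; exact hx)
  have := Nat.mul_le_mul_left B this
  omega

noncomputable def E (i : ℕ) (f : ℕ → ℝ) : ℕ → ℝ := avg (2 ^ i) f

lemma pow_split {i j : ℕ} (h : i ≤ j) : 2 ^ j = 2 ^ i * 2 ^ (j - i) := by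
  rw [← pow_add]; congr 1; omega

lemma meas_E (i : ℕ) (f) : Meas (2 ^ i) (E i f) := meas_avg (by positivity) f

lemma Meas.mono2 {i j : ℕ} (h : i ≤ j) {φ} (hφ : Meas (2 ^ j) φ) : Meas (2 ^ i) φ := by
  rw [pow_split h] at hφ
  exact hφ.mono (by positivity)

lemma E_adjoint {i N : ℕ} (h : i ≤ N) (φ f : ℕ → ℝ) (hφ : Meas (2 ^ i) φ) :
    ∑ x ∈ Finset.range (2 ^ N), φ x * E i f x = ∑ x ∈ Finset.range (2 ^ N), φ x * f x := by
  rw [pow_split h]; exact adjoint (by positivity) _ _ _ hφ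

lemma E_tower {i j : ℕ} (h : i ≤ j) (f) : E j (E i f) = E j f := by
  unfold E; rw [pow_split h]; exact avg_tower (by positivity) _ _

lemma E_fix {i j : ℕ} (h : i ≤ j) (f) : E i (E j f) = E j f :=
  avg_of_meas (by positivity) _ ((meas_E j f).mono2 h)

lemma E_vanish {i N : ℕ} (h : i ≤ N) (f : ℕ → ℝ) (hf : ∀ x, 2 ^ N ≤ x → f x = 0) (x : ℕ)
    (hx : 2 ^ N ≤ x) : E i f x = 0 := by
  rw [pow_split h] at hf hx
  exact avg_zero (by positivity) f hf x hx

lemma E_zero (f) : E 0 f = f := by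
  funext x; simp [E, avg]

/-- Pythagoras -/
lemma E_pyth {p q N : ℕ} (hpq : p ≤ q) (hq : q ≤ N) (f : ℕ → ℝ) :
    ∑ x ∈ Finset.range (2 ^ N), (E p f x - E q f x) ^ 2
      = ∑ x ∈ Finset.range (2 ^ N), (E p f x) ^ 2 - ∑ x ∈ Finset.range (2 ^ N), (E q f x) ^ 2 := by
  have h1 := E_adjoint (hpq.trans hq) (E q f) f ((meas_E q f).mono2 hpq)
  have h2 := E_adjoint hq (E q f) f (meas_E q f)
  have : ∀ x, (E p f x - E q f x) ^ 2
      = (E p f x) ^ 2 - 2 * (E q f x * E p f x) + E q f x * E q f x := fun x => by ring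
  simp only [this, Finset.sum_add_distrib, Finset.sum_sub_distrib, ← Finset.mul_sum]
  rw [h1, ← h2]
  simp only [← pow_two]
  ring

lemma doob_aux {q N : ℕ} (hq : q ≤ N) (g : ℕ → ℝ) (d : ℕ) (hd : d ≤ q) :
    ∃ m : ℕ → ℝ, Meas (2 ^ (q - d)) m ∧ (∀ i, q - d ≤ i → i ≤ q → ∀ x, E i g x ≤ m x) ∧
      ∑ x ∈ Finset.range (2 ^ N), ((m x) ^ 2 - 2 * (m x * g x)) ≤ 0 := by
  induction d with
  | zero =>
    refine ⟨E q g, meas_E q g, ?_, ?_⟩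
    · intro i h1 h2 x
      have : i = q := by omega
      rw [this]
    · rw [Finset.sum_sub_distrib, ← Finset.mul_sum, ← E_adjoint hq _ _ (meas_E q g)]
      simp only [← pow_two]
      have : 0 ≤ ∑ x ∈ Finset.range (2 ^ N), (E q g x) ^ 2 :=
        Finset.sum_nonneg fun _ _ => sq_nonneg _
      linarith
  | succ d ih =>
    obtain ⟨m, hm, hb, hs⟩ := ih (by omega)
    set i := q - (d + 1) with hi
    have hm' : Meas (2 ^ i) m := hm.mono2 (by omega)
    have hM : Meas (2 ^ i) (fun x => max (m x) (E i g x)) := fun x => by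
      simp only []
      rw [← hm' x, ← meas_E i g x]
    refine ⟨fun x => max (m x) (E i g x), hM, ?_, ?_⟩
    · intro k h1 h2 x
      rcases Nat.eq_or_lt_of_le h1 with h | h
      · subst h; exact le_max_right _ _
      · exact (hb k (by omega) h2 x).trans (le_max_left _ _)
    · have hψ : Meas (2 ^ i) (fun x => max (m x) (E i g x) - m x) := fun x => by
        simp only []
        rw [← hm' x, ← meas_E i g x]
      have h1 := E_adjoint (show i ≤ N by omega) _ g hψ
      have h2 : ∑ x ∈ Finset.range (2 ^ N), ((max (m x) (E i g x)) ^ 2 - (m x) ^ 2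
          - 2 * ((max (m x) (E i g x) - m x) * E i g x)) ≤ 0 := by
        apply Finset.sum_nonpos
        intro x _
        rcases le_total (m x) (E i g x) with h | h
        · rw [max_eq_right h]; nlinarith
        · rw [max_eq_left h]; simp
      have h3 : ∑ x ∈ Finset.range (2 ^ N),
            ((max (m x) (E i g x)) ^ 2 - 2 * (max (m x) (E i g x) * g x))
          = ∑ x ∈ Finset.range (2 ^ N), ((m x) ^ 2 - 2 * (m x * g x))
          + (∑ x ∈ Finset.range (2 ^ N), ((max (m x) (E i g x)) ^ 2 - (m x) ^ 2)
            - 2 * ∑ x ∈ Finset.range (2 ^ N), (max (m x) (E i g x) - m x) * g x) := by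
        rw [Finset.mul_sum, ← Finset.sum_sub_distrib, ← Finset.sum_add_distrib]
        refine Finset.sum_congr rfl fun x _ => by ring
      rw [Finset.sum_sub_distrib, ← Finset.mul_sum] at h2
      rw [h3, ← h1]
      linarith

lemma doob {p q N : ℕ} (hpq : p ≤ q) (hq : q ≤ N) (g : ℕ → ℝ) :
    ∃ m : ℕ → ℝ, (∀ i, p ≤ i → i ≤ q → ∀ x, E i g x ≤ m x) ∧
      ∑ x ∈ Finset.range (2 ^ N), (m x) ^ 2 ≤ 4 * ∑ x ∈ Finset.range (2 ^ N), (g x) ^ 2 := by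
  obtain ⟨m, -, hb, hs⟩ := doob_aux hq g (q - p) (by omega)
  refine ⟨m, fun i h1 h2 => hb i (by omega) h2, ?_⟩
  have : ∑ x ∈ Finset.range (2 ^ N), ((m x) ^ 2 - 4 * (g x) ^ 2)
      ≤ ∑ x ∈ Finset.range (2 ^ N), 2 * ((m x) ^ 2 - 2 * (m x * g x)) := by
    refine Finset.sum_le_sum fun x _ => ?_
    nlinarith [sq_nonneg (m x - 2 * g x)]
  rw [Finset.sum_sub_distrib, ← Finset.mul_sum, ← Finset.mul_sum] at this
  linarith

lemma osc {p q N : ℕ} (hpq : p ≤ q) (hq : q ≤ N) (f : ℕ → ℝ) :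
    ∃ D : ℕ → ℝ, (∀ i, p ≤ i → i ≤ q → ∀ x, (E i f x - E p f x) ^ 2 ≤ D x) ∧
      ∑ x ∈ Finset.range (2 ^ N), D x ≤ 10 * (∑ x ∈ Finset.range (2 ^ N), (E p f x) ^ 2
        - ∑ x ∈ Finset.range (2 ^ N), (E q f x) ^ 2) := by
  obtain ⟨m, hb, hs⟩ := doob hpq hq (fun x => |E p f x - E q f x|)
  refine ⟨fun x => 2 * (m x) ^ 2 + 2 * (E p f x - E q f x) ^ 2, ?_, ?_⟩
  · intro i h1 h2 x
    have h3 := hb i h1 h2 x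
    have h4 : |E i f x - E q f x| ≤ m x := by
      refine le_trans ?_ h3
      have := avg_abs (2 ^ i) (fun y => E p f y - E q f y) x
      rw [avg_sub] at this
      change |E i (E p f) x - E i (E q f) x| ≤ _ at this
      rw [E_tower h1, E_fix h2] at this
      exact this
    have h5 : (E i f x - E q f x) ^ 2 ≤ (m x) ^ 2 := by
      rw [← sq_abs]; gcongr
    nlinarith [sq_nonneg ((E i f x - E q f x) + (E p f x - E q f x))]
  · rw [← E_pyth hpq hq]
    simp only [sq_abs] at hs
    rw [Finset.sum_add_distrib, ← Finset.mul_sum, ← Finset.mul_sum]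
    linarith

lemma shift_sum {T : ℕ} (l : ℕ) (g : ℕ → ℝ) (h0 : ∀ x, 0 ≤ g x) (hz : ∀ x, T ≤ x → g x = 0) :
    ∑ x ∈ Finset.range T, g (x + l) ≤ ∑ x ∈ Finset.range T, g x := by
  have h1 := Finset.sum_range_add g l T
  have h2 := Finset.sum_range_add g T l
  rw [Finset.sum_eq_zero (s := Finset.range l) (f := fun x => g (T + x))
    (fun x _ => hz _ (by omega)), add_comm T l, h1] at h2
  have : 0 ≤ ∑ x ∈ Finset.range l, g x := Finset.sum_nonneg fun _ _ => h0 _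
  simp only [add_comm _ l]
  linarith

lemma low {B m : ℕ} (hB : 0 < B) (hm : B ≤ m) (h : ℕ → ℝ)
    (hz : ∀ k, ∑ y ∈ Finset.range (B * k), h y = 0) (x : ℕ) :
    (∑ l ∈ Finset.range m, h (x + l)) ^ 2 ≤ 4 * B * ∑ l ∈ Finset.range m, (h (x + l)) ^ 2 := by
  set G : ℕ → ℝ := fun t => ∑ y ∈ Finset.range t, h y with hG
  have hS : ∑ l ∈ Finset.range m, h (x + l) = G (x + m) - G x := by
    simp only [hG, Finset.sum_range_add]; ring
  set W := ∑ l ∈ Finset.range m, (h (x + l)) ^ 2 with hW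
  have hW0 : 0 ≤ W := Finset.sum_nonneg fun _ _ => sq_nonneg _
  have a1 : (G x) ^ 2 ≤ B * W := by
    have hc := hz (x / B + 1)
    have hdm := Nat.div_add_mod x B
    have hlt := Nat.mod_lt x hB
    obtain ⟨e, he⟩ : ∃ e, e = B - x % B := ⟨_, rfl⟩
    have : B * (x / B + 1) = x + e := by rw [mul_add]; omega
    rw [this, Finset.sum_range_add] at hc
    have : G x = - ∑ l ∈ Finset.range e, h (x + l) := by simp only [hG]; linarith
    rw [this, neg_sq]
    refine (sq_sum_le_card_mul_sum_sq).trans ?_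
    rw [Finset.card_range]
    have : ∑ l ∈ Finset.range e, (h (x + l)) ^ 2 ≤ W :=
      Finset.sum_le_sum_of_subset_of_nonneg (Finset.range_mono (by omega))
        fun _ _ _ => sq_nonneg _
    have he' : (e : ℝ) ≤ B := by exact_mod_cast (by omega : e ≤ B)
    gcongr
  have a2 : (G (x + m)) ^ 2 ≤ B * W := by
    have hc := hz ((x + m) / B)
    have hdm := Nat.div_add_mod (x + m) B
    have hlt := Nat.mod_lt (x + m) hB
    obtain ⟨e, he⟩ : ∃ e, e = (x + m) % B := ⟨_, rfl⟩
    obtain ⟨t, ht⟩ : ∃ t, m = t + e := ⟨m - e, by omega⟩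
    have hb : B * ((x + m) / B) = x + t := by omega
    rw [hb] at hc
    have : G (x + m) = ∑ l ∈ Finset.range e, h (x + t + l) := by
      simp only [hG]
      rw [ht, ← add_assoc, Finset.sum_range_add, hc, zero_add]
    rw [this]
    refine (sq_sum_le_card_mul_sum_sq).trans ?_
    rw [Finset.card_range]
    have : ∑ l ∈ Finset.range e, (h (x + t + l)) ^ 2 ≤ W := by
      rw [hW, ht, Finset.sum_range_add]
      simp only [← add_assoc]
      have : 0 ≤ ∑ l ∈ Finset.range t, (h (x + l)) ^ 2 := Finset.sum_nonneg fun _ _ => sq_nonneg _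
      linarith
    have he' : (e : ℝ) ≤ B := by exact_mod_cast (by omega : e ≤ B)
    gcongr
  rw [hS]
  nlinarith [sq_nonneg (G (x + m) + G x)]

lemma high {B Q : ℕ} (hB : 0 < B) (d : ℕ → ℝ) (hd : Meas B d) (hz : ∀ x, B * Q ≤ x → d x = 0)
    (l : ℕ) :
    ∑ x ∈ Finset.range (B * Q), (d (x + l) - d x) ^ 2
      ≤ 4 * (l / B) * ∑ x ∈ Finset.range (B * Q), (d x) ^ 2 := by
  have hB' : (0 : ℝ) < B := by positivity
  have hS : 0 ≤ ∑ x ∈ Finset.range (B * Q), (d x) ^ 2 := Finset.sum_nonneg fun _ _ => sq_nonneg _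
  rcases le_or_gt B l with h | h
  · have h1 := shift_sum l (fun x => (d x) ^ 2) (fun x => sq_nonneg _)
      (fun x hx => by rw [hz x hx]; simp)
    have h2 : ∑ x ∈ Finset.range (B * Q), (d (x + l) - d x) ^ 2
        ≤ ∑ x ∈ Finset.range (B * Q), (2 * (d (x + l)) ^ 2 + 2 * (d x) ^ 2) :=
      Finset.sum_le_sum fun x _ => by nlinarith [sq_nonneg (d (x + l) + d x)]
    rw [Finset.sum_add_distrib, ← Finset.mul_sum, ← Finset.mul_sum] at h2
    have h3 : (1 : ℝ) ≤ l / B := by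
      rw [le_div_iff₀ hB', one_mul]; exact_mod_cast h
    nlinarith
  · have e1 : ∑ x ∈ Finset.range (B * Q), (d x) ^ 2
        = B * ∑ q ∈ Finset.range Q, (d (B * q)) ^ 2 := by
      rw [sum_mul, Finset.mul_sum]
      refine Finset.sum_congr rfl fun q _ => ?_
      rw [Finset.sum_congr rfl (fun r hr => by rw [hd.block (Finset.mem_range.1 hr)])]
      simp
    have e2 : ∑ x ∈ Finset.range (B * Q), (d (x + l) - d x) ^ 2
        = l * ∑ q ∈ Finset.range Q, (d (B * (q + 1)) - d (B * q)) ^ 2 := by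
      rw [sum_mul, Finset.mul_sum]
      refine Finset.sum_congr rfl fun q _ => ?_
      obtain ⟨c, hc⟩ : ∃ c, B = c + l := ⟨B - l, by omega⟩
      have : Finset.range B = Finset.range (c + l) := by rw [hc]
      rw [this, Finset.sum_range_add, Finset.sum_eq_zero, zero_add]
      · rw [Finset.sum_congr (g := fun _ => (d (B * (q + 1)) - d (B * q)) ^ 2) rfl]
        · simp
        · intro r hr
          have hr := Finset.mem_range.1 hr
          have : B * q + (c + r) + l = B * (q + 1) + r := by rw [mul_add]; omega
          rw [this, hd.block (by omega), hd.block (by omega)]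
      · intro r hr
        have hr := Finset.mem_range.1 hr
        rw [add_assoc, hd.block (by omega), hd.block (by omega)]; simp
    have h1 := shift_sum (T := Q) 1 (fun x => (d (B * x)) ^ 2) (fun x => sq_nonneg _)
      (fun x hx => by
        rw [hz _ (Nat.mul_le_mul_left B hx)]; simp)
    have h2 : ∑ q ∈ Finset.range Q, (d (B * (q + 1)) - d (B * q)) ^ 2
        ≤ ∑ q ∈ Finset.range Q, (2 * (d (B * (q + 1))) ^ 2 + 2 * (d (B * q)) ^ 2) :=
      Finset.sum_le_sum fun x _ => by nlinarith [sq_nonneg (d (B * (x + 1)) + d (B * x))]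
    rw [Finset.sum_add_distrib, ← Finset.mul_sum, ← Finset.mul_sum] at h2
    rw [e1, e2]
    have : 4 * ((l : ℝ) / B) * (B * ∑ q ∈ Finset.range Q, (d (B * q)) ^ 2)
        = l * (4 * ∑ q ∈ Finset.range Q, (d (B * q)) ^ 2) := by field_simp
    rw [this]
    gcongr
    linarith

lemma geo {ρ : ℝ} (h0 : 0 ≤ ρ) (h1 : ρ < 1) (i n : ℕ) :
    ∑ j ∈ Finset.range n, ρ ^ ((i - j) + (j - i)) ≤ 2 * (1 - ρ)⁻¹ := by
  have hg : ∀ k, ∑ j ∈ Finset.range k, ρ ^ j ≤ (1 - ρ)⁻¹ := by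
    intro k
    rw [← tsum_geometric_of_lt_one h0 h1]
    exact (summable_geometric_of_lt_one h0 h1).sum_le_tsum _ fun _ _ => by positivity
  have a1 : ∑ j ∈ Finset.range n, ρ ^ ((i - j) + (j - i))
      ≤ ∑ j ∈ Finset.range (i + n), ρ ^ ((i - j) + (j - i)) :=
    Finset.sum_le_sum_of_subset_of_nonneg (Finset.range_mono (by omega))
      fun _ _ _ => by positivity
  rw [Finset.sum_range_add] at a1
  have a2 : ∑ j ∈ Finset.range n, ρ ^ ((i - (i + j)) + (i + j - i)) = ∑ j ∈ Finset.range n, ρ ^ j :=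
    Finset.sum_congr rfl fun j _ => by congr 1; omega
  have a3 : ∑ j ∈ Finset.range i, ρ ^ ((i - j) + (j - i)) ≤ ∑ j ∈ Finset.range i, ρ ^ j := by
    rw [← Finset.sum_range_reflect (fun j => ρ ^ j)]
    refine Finset.sum_le_sum fun j hj => ?_
    have := Finset.mem_range.1 hj
    exact pow_le_pow_of_le_one h0 h1.le (by omega)
  have := hg n
  have := hg i
  linarith

lemma tel (u : ℕ → ℝ) (i n : ℕ) (h : i ≤ n) :
    ∑ j ∈ Finset.range n, (if i ≤ j then u j - u (j + 1) else 0) = u i - u n := by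
  induction n, h using Nat.le_induction with
  | base =>
    rw [sub_self]
    refine Finset.sum_eq_zero fun j hj => ?_
    have := Finset.mem_range.1 hj
    rw [if_neg (by omega)]
  | succ n h ih => rw [Finset.sum_range_succ, ih, if_pos h]; ring

lemma A_sum (m : ℕ) (s : Finset ℕ) (d : ℕ → ℕ → ℝ) (x : ℕ) :
    A m (fun y => ∑ j ∈ s, d j y) x = ∑ j ∈ s, A m (d j) x := by
  unfold A
  rw [Finset.sum_comm, Finset.sum_div]

/-- high frequency pointwise -/
lemma high_pt {i m : ℕ} (h1 : 2 ^ i ≤ m) (h2 : m < 2 ^ (i + 1)) (d : ℕ → ℝ) (x : ℕ) :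
    (A m d x - d x) ^ 2
      ≤ (1 / 2 ^ i) * ∑ l ∈ Finset.range (2 ^ (i + 1)), (d (x + l) - d x) ^ 2 := by
  have hp : (0 : ℝ) < 2 ^ i := by positivity
  have hm : (2 : ℝ) ^ i ≤ m := by exact_mod_cast h1
  have hm0 : (0 : ℝ) < m := hp.trans_le hm
  have e : A m d x - d x = (∑ l ∈ Finset.range m, (d (x + l) - d x)) / m := by
    unfold A; rw [Finset.sum_sub_distrib]; simp; field_simp
  have h3 : (∑ l ∈ Finset.range m, (d (x + l) - d x)) ^ 2
      ≤ m * ∑ l ∈ Finset.range m, (d (x + l) - d x) ^ 2 := by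
    refine sq_sum_le_card_mul_sum_sq.trans ?_
    rw [Finset.card_range]
  have h4 : ∑ l ∈ Finset.range m, (d (x + l) - d x) ^ 2
      ≤ ∑ l ∈ Finset.range (2 ^ (i + 1)), (d (x + l) - d x) ^ 2 :=
    Finset.sum_le_sum_of_subset_of_nonneg (Finset.range_mono h2.le) fun _ _ _ => sq_nonneg _
  rw [e, div_pow]
  calc _ ≤ (m * ∑ l ∈ Finset.range m, (d (x + l) - d x) ^ 2) / (m : ℝ) ^ 2 := by gcongr
    _ = (1 / m) * ∑ l ∈ Finset.range m, (d (x + l) - d x) ^ 2 := by field_simp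
    _ ≤ _ := by gcongr

lemma low_pt {i j m : ℕ} (hj : j < i) (h1 : 2 ^ i ≤ m) (h2 : m < 2 ^ (i + 1)) (d : ℕ → ℝ)
    (hz : ∀ k, ∑ y ∈ Finset.range (2 ^ (j + 1) * k), d y = 0) (x : ℕ) :
    (A m d x) ^ 2
      ≤ (8 * 2 ^ j / (2 ^ i) ^ 2) * ∑ l ∈ Finset.range (2 ^ (i + 1)), (d (x + l)) ^ 2 := by
  have hp : (0 : ℝ) < 2 ^ i := by positivity
  have hm : (2 : ℝ) ^ i ≤ m := by exact_mod_cast h1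
  have h3 := low (by positivity) ((Nat.pow_le_pow_right (by norm_num) (by omega)).trans h1) d hz x
  have h4 : ∑ l ∈ Finset.range m, (d (x + l)) ^ 2
      ≤ ∑ l ∈ Finset.range (2 ^ (i + 1)), (d (x + l)) ^ 2 :=
    Finset.sum_le_sum_of_subset_of_nonneg (Finset.range_mono h2.le) fun _ _ _ => sq_nonneg _
  unfold A
  rw [div_pow]
  calc _ ≤ (4 * (2 ^ (j + 1) : ℕ) * ∑ l ∈ Finset.range (2 ^ (i + 1)), (d (x + l)) ^ 2)
        / ((2 : ℝ) ^ i) ^ 2 := by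
          gcongr
          exact h3.trans (by gcongr)
    _ = _ := by push_cast; rw [pow_succ]; ring

lemma high_sum {i j N : ℕ} (hij : i ≤ j) (hj : j ≤ N) (d : ℕ → ℝ) (hd : Meas (2 ^ j) d)
    (hz : ∀ x, 2 ^ N ≤ x → d x = 0) :
    ∑ x ∈ Finset.range (2 ^ N),
      (1 / 2 ^ i) * ∑ l ∈ Finset.range (2 ^ (i + 1)), (d (x + l) - d x) ^ 2
      ≤ 16 * (1 / 2) ^ ((i - j) + (j - i)) * ∑ x ∈ Finset.range (2 ^ N), (d x) ^ 2 := by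
  rw [← Finset.mul_sum, Finset.sum_comm]
  set S := ∑ x ∈ Finset.range (2 ^ N), (d x) ^ 2 with hS
  have hS0 : 0 ≤ S := Finset.sum_nonneg fun _ _ => sq_nonneg _
  have h1 : ∀ l ∈ Finset.range (2 ^ (i + 1)),
      ∑ x ∈ Finset.range (2 ^ N), (d (x + l) - d x) ^ 2 ≤ 4 * (2 ^ (i + 1) / 2 ^ j) * S := by
    intro l hl
    have hl : (l : ℝ) ≤ 2 ^ (i + 1) := by exact_mod_cast (Finset.mem_range.1 hl).le
    rw [pow_split hj] at hz hS ⊢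
    refine (high (by positivity) d hd hz l).trans ?_
    rw [← hS]
    push_cast
    gcongr
  refine (mul_le_mul_of_nonneg_left (Finset.sum_le_sum h1) (by positivity)).trans ?_
  obtain ⟨c, rfl⟩ := Nat.exists_eq_add_of_le hij
  rw [Finset.sum_const, Finset.card_range, nsmul_eq_mul]
  have : (i - (i + c)) + (i + c - i) = c := by omega
  rw [this]
  apply le_of_eq
  push_cast
  rw [one_div_pow, pow_add, pow_add]
  field_simp
  ring

lemma low_sum {i j N : ℕ} (hij : j < i) (d : ℕ → ℝ)
    (hz : ∀ x, 2 ^ N ≤ x → d x = 0) :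
    ∑ x ∈ Finset.range (2 ^ N),
      (8 * 2 ^ j / (2 ^ i) ^ 2) * ∑ l ∈ Finset.range (2 ^ (i + 1)), (d (x + l)) ^ 2
      ≤ 16 * (1 / 2) ^ ((i - j) + (j - i)) * ∑ x ∈ Finset.range (2 ^ N), (d x) ^ 2 := by
  rw [← Finset.mul_sum, Finset.sum_comm]
  have h1 : ∀ l ∈ Finset.range (2 ^ (i + 1)),
      ∑ x ∈ Finset.range (2 ^ N), (d (x + l)) ^ 2 ≤ ∑ x ∈ Finset.range (2 ^ N), (d x) ^ 2 := by
    intro l hl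
    exact shift_sum l (fun x => (d x) ^ 2) (fun x => sq_nonneg _)
      (fun x hx => by rw [hz x hx]; simp)
  refine (mul_le_mul_of_nonneg_left (Finset.sum_le_sum h1) (by positivity)).trans ?_
  obtain ⟨c, rfl⟩ := Nat.exists_eq_add_of_le hij.le
  rw [Finset.sum_const, Finset.card_range, nsmul_eq_mul]
  have : (j + c - j) + (j - (j + c)) = c := by omega
  rw [this]
  apply le_of_eq
  push_cast
  rw [one_div_pow, pow_add, pow_add]
  field_simp
  ring

lemma compare (N : ℕ) (f : ℕ → ℝ) (hf : ∀ x, 2 ^ N ≤ x → f x = 0) :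
    ∃ H : ℕ → ℕ → ℝ, (∀ i x, 0 ≤ H i x) ∧
      (∀ i m x, i ≤ N → 2 ^ i ≤ m → m < 2 ^ (i + 1) → (A m f x - E i f x) ^ 2 ≤ H i x) ∧
      ∑ i ∈ Finset.range (N + 1), ∑ x ∈ Finset.range (2 ^ N), H i x
        ≤ 768 * ∑ x ∈ Finset.range (2 ^ N), (f x) ^ 2 := by
  set P : ℕ → ℕ → ℝ := fun j x => if j ≤ N then E j f x else 0 with hP
  set d : ℕ → ℕ → ℝ := fun j x => P j x - P (j + 1) x with hdd
  have dlt : ∀ j, j < N → d j = fun x => E j f x - E (j + 1) f x := by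
    intro j hj; funext x; simp only [hdd, hP]
    rw [if_pos hj.le, if_pos (by omega : j + 1 ≤ N)]
  have dN : d N = E N f := by
    funext x; simp [hdd, hP]
  have dmeas : ∀ j, j ≤ N → Meas (2 ^ j) (d j) := by
    intro j hj
    rcases Nat.eq_or_lt_of_le hj with h | h
    · subst h; rw [dN]; exact meas_E _ _
    · rw [dlt j h]; intro x
      change E j f x - E (j + 1) f x = E j f _ - E (j + 1) f _
      rw [← meas_E j f x, ← (meas_E (j + 1) f).mono2 (Nat.le_succ j) x]
  have dz : ∀ j, j ≤ N → ∀ x, 2 ^ N ≤ x → d j x = 0 := by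
    intro j hj x hx
    rcases Nat.eq_or_lt_of_le hj with h | h
    · subst h; rw [dN]; exact E_vanish le_rfl f hf x hx
    · rw [dlt j h]
      simp only []
      rw [E_vanish hj f hf x hx, E_vanish h f hf x hx, sub_zero]
  have dzs : ∀ j, j < N → ∀ k, ∑ y ∈ Finset.range (2 ^ (j + 1) * k), d j y = 0 := by
    intro j hj k
    rw [dlt j hj, Finset.sum_sub_distrib]
    have a1 := adjoint (B := 2 ^ (j + 1)) (by positivity) k (fun _ => 1) f (fun _ => rfl)
    have a2 := adjoint (B := 2 ^ j) (by positivity) (2 * k) (fun _ => 1) f (fun _ => rfl)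
    have e : 2 ^ j * (2 * k) = 2 ^ (j + 1) * k := by ring
    rw [e] at a2
    simp only [one_mul] at a1 a2
    unfold E
    rw [a1, a2, sub_self]
  have dsum : ∑ j ∈ Finset.range (N + 1), ∑ x ∈ Finset.range (2 ^ N), (d j x) ^ 2
      ≤ ∑ x ∈ Finset.range (2 ^ N), (f x) ^ 2 := by
    rw [Finset.sum_range_succ, dN]
    have : ∀ j ∈ Finset.range N, ∑ x ∈ Finset.range (2 ^ N), (d j x) ^ 2
        = ∑ x ∈ Finset.range (2 ^ N), (E j f x) ^ 2
          - ∑ x ∈ Finset.range (2 ^ N), (E (j + 1) f x) ^ 2 := by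
      intro j hj
      have hj := Finset.mem_range.1 hj
      rw [dlt j hj, E_pyth (Nat.le_succ j) hj]
    rw [Finset.sum_congr rfl this,
      Finset.sum_range_sub' (fun j => ∑ x ∈ Finset.range (2 ^ N), (E j f x) ^ 2), E_zero]
    simp
  have Esum : ∀ i ≤ N, ∀ x, E i f x
      = ∑ j ∈ Finset.range (N + 1), if i ≤ j then d j x else 0 := by
    intro i hi x
    have := tel (fun j => P j x) i (N + 1) (by omega)
    simp only [hdd]
    rw [this]
    simp [hP, hi]
  have fsum : f = fun x => ∑ j ∈ Finset.range (N + 1), d j x := by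
    funext x
    have := Esum 0 (by omega) x
    rw [E_zero] at this
    simpa using this
  set G : ℕ → ℕ → ℕ → ℝ := fun i j x =>
    if i ≤ j then (1 / 2 ^ i) * ∑ l ∈ Finset.range (2 ^ (i + 1)), (d j (x + l) - d j x) ^ 2
    else (8 * 2 ^ j / (2 ^ i) ^ 2) * ∑ l ∈ Finset.range (2 ^ (i + 1)), (d j (x + l)) ^ 2 with hG
  have G0 : ∀ i j x, 0 ≤ G i j x := by
    intro i j x
    simp only [hG]
    split_ifs
    · exact mul_nonneg (by positivity) (Finset.sum_nonneg fun _ _ => sq_nonneg _)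
    · exact mul_nonneg (by positivity) (Finset.sum_nonneg fun _ _ => sq_nonneg _)
  have Gpt : ∀ i j m x, i ≤ N → j ≤ N → 2 ^ i ≤ m → m < 2 ^ (i + 1) →
      (A m (d j) x - if i ≤ j then d j x else 0) ^ 2 ≤ G i j x := by
    intro i j m x hi hj h1 h2
    simp only [hG]
    split_ifs with h
    · exact high_pt h1 h2 _ _
    · rw [sub_zero]
      exact low_pt (by omega) h1 h2 _ (dzs j (by omega)) x
  have Gsum : ∀ i j, j ≤ N → ∑ x ∈ Finset.range (2 ^ N), G i j x
      ≤ 16 * (1 / 2) ^ ((i - j) + (j - i)) * ∑ x ∈ Finset.range (2 ^ N), (d j x) ^ 2 := by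
    intro i j hj
    simp only [hG]
    split_ifs with h
    · exact high_sum h hj _ (dmeas j hj) (dz j hj)
    · exact low_sum (by omega) _ (dz j hj)
  refine ⟨fun i x => 8 * ∑ j ∈ Finset.range (N + 1), (4 / 3) ^ ((i - j) + (j - i)) * G i j x,
    ?_, ?_, ?_⟩
  · intro i x
    exact mul_nonneg (by norm_num) (Finset.sum_nonneg fun j _ => mul_nonneg (by positivity) (G0 _ _ _))
  · intro i m x hi h1 h2
    have e : A m f x - E i f x = ∑ j ∈ Finset.range (N + 1),
        (A m (d j) x - if i ≤ j then d j x else 0) := by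
      rw [Finset.sum_sub_distrib, ← Esum i hi x, ← A_sum, ← fsum]
    rw [e]
    refine (Finset.sum_sq_le_sum_mul_sum_of_sq_le_mul (Finset.range (N + 1))
      (f := fun j => (3 / 4 : ℝ) ^ ((i - j) + (j - i)))
      (g := fun j => (4 / 3 : ℝ) ^ ((i - j) + (j - i))
        * (A m (d j) x - if i ≤ j then d j x else 0) ^ 2) ?_ ?_ ?_).trans ?_
    · intro j _; positivity
    · intro j _; positivity
    · intro j _
      apply le_of_eq; rw [← mul_assoc, ← mul_pow]; norm_num
    · have g := geo (ρ := 3 / 4) (by norm_num) (by norm_num) i (N + 1)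
      norm_num at g
      refine mul_le_mul g ?_ (Finset.sum_nonneg fun j _ => by positivity) (by norm_num)
      refine Finset.sum_le_sum fun j hj => ?_
      have := Gpt i j m x hi (by have := Finset.mem_range.1 hj; omega) h1 h2
      gcongr
  · have step : ∀ i, ∑ x ∈ Finset.range (2 ^ N),
        8 * ∑ j ∈ Finset.range (N + 1), (4 / 3) ^ ((i - j) + (j - i)) * G i j x
        ≤ ∑ j ∈ Finset.range (N + 1), 128 * (2 / 3 : ℝ) ^ ((j - i) + (i - j))
          * ∑ x ∈ Finset.range (2 ^ N), (d j x) ^ 2 := by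
      intro i
      rw [← Finset.mul_sum, Finset.sum_comm, Finset.mul_sum]
      refine Finset.sum_le_sum fun j hj => ?_
      rw [← Finset.mul_sum]
      have := Gsum i j (by have := Finset.mem_range.1 hj; omega)
      calc _ ≤ 8 * ((4 / 3) ^ ((i - j) + (j - i)) * (16 * (1 / 2) ^ ((i - j) + (j - i))
            * ∑ x ∈ Finset.range (2 ^ N), (d j x) ^ 2)) := by gcongr
        _ = 128 * ((4 / 3) * (1 / 2)) ^ ((i - j) + (j - i))
            * ∑ x ∈ Finset.range (2 ^ N), (d j x) ^ 2 := by rw [mul_pow]; ring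
        _ = _ := by rw [add_comm (i - j)]; norm_num
    refine (Finset.sum_le_sum fun i _ => step i).trans ?_
    rw [Finset.sum_comm]
    refine le_trans ?_ (mul_le_mul_of_nonneg_left dsum (by norm_num))
    rw [Finset.mul_sum]
    refine Finset.sum_le_sum fun j _ => ?_
    rw [← Finset.sum_mul, ← Finset.mul_sum]
    have g := geo (ρ := 2 / 3) (by norm_num) (by norm_num) j (N + 1)
    norm_num at g
    have : 0 ≤ ∑ x ∈ Finset.range (2 ^ N), (d j x) ^ 2 := Finset.sum_nonneg fun _ _ => sq_nonneg _
    gcongr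
    linarith

lemma sum_consec (p : ℕ → ℕ) (hp : Monotone p) (K : ℕ) (g : ℕ → ℝ) :
    ∑ k ∈ Finset.range K, ∑ i ∈ Finset.Ico (p k) (p (k + 1)), g i
      = ∑ i ∈ Finset.Ico (p 0) (p K), g i := by
  induction K with
  | zero => simp
  | succ K ih =>
    rw [Finset.sum_range_succ, ih,
      Finset.sum_Ico_consecutive _ (hp (Nat.zero_le K)) (hp (Nat.le_succ K))]

lemma A_norm {T m : ℕ} (hm : 0 < m) (f : ℕ → ℝ) (hf : ∀ x, T ≤ x → f x = 0) :
    ∑ x ∈ Finset.range T, (A m f x) ^ 2 ≤ ∑ x ∈ Finset.range T, (f x) ^ 2 := by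
  have hm' : (0 : ℝ) < m := by positivity
  have h1 : ∀ x ∈ Finset.range T, (A m f x) ^ 2
      ≤ (1 / m) * ∑ l ∈ Finset.range m, (f (x + l)) ^ 2 := by
    intro x _
    have h3 : (∑ l ∈ Finset.range m, f (x + l)) ^ 2
        ≤ m * ∑ l ∈ Finset.range m, (f (x + l)) ^ 2 := by
      refine sq_sum_le_card_mul_sum_sq.trans ?_
      rw [Finset.card_range]
    unfold A
    rw [div_pow]
    calc _ ≤ (m * ∑ l ∈ Finset.range m, (f (x + l)) ^ 2) / (m : ℝ) ^ 2 := by gcongr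
      _ = _ := by field_simp
  refine (Finset.sum_le_sum h1).trans ?_
  rw [← Finset.mul_sum, Finset.sum_comm]
  have h2 : ∀ l ∈ Finset.range m, ∑ x ∈ Finset.range T, (f (x + l)) ^ 2
      ≤ ∑ x ∈ Finset.range T, (f x) ^ 2 := fun l _ =>
    shift_sum l (fun x => (f x) ^ 2) (fun x => sq_nonneg _) (fun x hx => by rw [hf x hx]; simp)
  refine (mul_le_mul_of_nonneg_left (Finset.sum_le_sum h2) (by positivity)).trans (le_of_eq ?_)
  rw [Finset.sum_const, Finset.card_range, nsmul_eq_mul]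
  field_simp

lemma five (a b c d e : ℝ) : (a + b + c + d + e) ^ 2
    ≤ 5 * (a ^ 2 + b ^ 2 + c ^ 2 + d ^ 2 + e ^ 2) := by
  nlinarith [sq_nonneg (a - b), sq_nonneg (a - c), sq_nonneg (a - d), sq_nonneg (a - e),
    sq_nonneg (b - c), sq_nonneg (b - d), sq_nonneg (b - e), sq_nonneg (c - d),
    sq_nonneg (c - e), sq_nonneg (d - e)]

noncomputable def M (m : ℕ) (f : ℕ → ℝ) (x : ℕ) : ℝ :=
  (1 / (m : ℝ)) * ∑ l ∈ Finset.range (m + 1), f (l + x)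

lemma M_eq {m : ℕ} (hm : 0 < m) (f : ℕ → ℝ) (x : ℕ) :
    M m f x = A (m + 1) f x + A (m + 1) f x / m := by
  unfold M A
  have hm' : (0 : ℝ) < m := by positivity
  simp only [add_comm _ x]
  push_cast
  field_simp

lemma core (n : ℕ → ℕ) (h2 : ∀ k, 2 ≤ n k) (h8 : ∀ k, (n k) ^ 8 < n (k + 1)) (K N : ℕ)
    (hN : Nat.log 2 (n (K + 1) + 1) ≤ N) (f : ℕ → ℝ) (hf : ∀ x, 2 ^ N ≤ x → f x = 0) :
    ∃ V : ℕ → ℕ → ℝ,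
      (∀ k, k < K → ∀ m ∈ Finset.Ico (n k) (n (k + 1)), ∀ x,
        (M m f x - M (n k) f x) ^ 2 ≤ V k x) ∧
      ∑ k ∈ Finset.range K, ∑ x ∈ Finset.range (2 ^ N), V k x
        ≤ 12000 * ∑ x ∈ Finset.range (2 ^ N), (f x) ^ 2 := by
  obtain ⟨H, H0, Hpt, Hs⟩ := compare N f hf
  set p : ℕ → ℕ := fun k => Nat.log 2 (n k + 1) with hp
  have hgrow : ∀ k, 2 * (n k + 1) ≤ n (k + 1) + 1 := by
    intro k
    have a := h8 k
    have b := h2 k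
    have : 2 ^ 7 * n k ≤ n k ^ 8 := by
      rw [pow_succ (n k) 7]; exact Nat.mul_le_mul_right _ (Nat.pow_le_pow_left b 7)
    omega
  have hnm : Monotone n := monotone_nat_of_le_succ fun k => by have := hgrow k; omega
  have hps : ∀ k, p k < p (k + 1) := by
    intro k
    have : Nat.log 2 ((n k + 1) * 2) = Nat.log 2 (n k + 1) + 1 :=
      Nat.log_mul_base (by norm_num) (by omega)
    have h3 : Nat.log 2 ((n k + 1) * 2) ≤ Nat.log 2 (n (k + 1) + 1) :=
      Nat.log_mono_right (by have := hgrow k; omega)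
    simp only [hp]
    omega
  have hpm : Monotone p := monotone_nat_of_le_succ fun k => (hps k).le
  have hpN : ∀ k, k ≤ K + 1 → p k ≤ N := fun k hk => (hpm hk).trans hN
  set F := ∑ x ∈ Finset.range (2 ^ N), (f x) ^ 2 with hF
  have hF0 : 0 ≤ F := Finset.sum_nonneg fun _ _ => sq_nonneg _
  set S : ℕ → ℕ → ℝ := fun k x => ∑ i ∈ Finset.Ico (p k) (p (k + 1)), H i x with hS
  have S0 : ∀ k x, 0 ≤ S k x := fun k x => Finset.sum_nonneg fun _ _ => H0 _ _
  have HS : ∀ k i x, p k ≤ i → i < p (k + 1) → H i x ≤ S k x := fun k i x ha hb =>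
    Finset.single_le_sum (f := fun i => H i x) (fun _ _ => H0 _ _) (Finset.mem_Ico.2 ⟨ha, hb⟩)
  have HS2 : ∀ k i x, p k ≤ i → i ≤ p (k + 1) → H i x ≤ S k x + S (k + 1) x := by
    intro k i x ha hb
    rcases Nat.eq_or_lt_of_le hb with h | h
    · subst h
      linarith [HS (k + 1) (p (k + 1)) x le_rfl (hps _), S0 k x]
    · linarith [HS k i x ha h, S0 (k + 1) x]
  have Ssum : ∑ k ∈ Finset.range (K + 1), ∑ x ∈ Finset.range (2 ^ N), S k x ≤ 768 * F := by
    have : ∀ k ∈ Finset.range (K + 1), ∑ x ∈ Finset.range (2 ^ N), S k x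
        = ∑ i ∈ Finset.Ico (p k) (p (k + 1)), ∑ x ∈ Finset.range (2 ^ N), H i x :=
      fun k _ => Finset.sum_comm
    rw [Finset.sum_congr rfl this, sum_consec p hpm]
    refine le_trans (Finset.sum_le_sum_of_subset_of_nonneg ?_ fun _ _ _ =>
      Finset.sum_nonneg fun _ _ => H0 _ _) Hs
    intro i hi
    have := Finset.mem_Ico.1 hi
    have := hpN (K + 1) le_rfl
    exact Finset.mem_range.2 (by omega)
  have SX0 : ∀ k, 0 ≤ ∑ x ∈ Finset.range (2 ^ N), S k x :=
    fun k => Finset.sum_nonneg fun _ _ => S0 _ _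
  have Ss1 : ∑ k ∈ Finset.range K, ∑ x ∈ Finset.range (2 ^ N), S k x ≤ 768 * F := by
    rw [Finset.sum_range_succ] at Ssum
    linarith [SX0 K]
  have Ss2 : ∑ k ∈ Finset.range K, ∑ x ∈ Finset.range (2 ^ N), S (k + 1) x ≤ 768 * F := by
    rw [Finset.sum_range_succ'] at Ssum
    linarith [SX0 0]
  have hD : ∀ k, ∃ D : ℕ → ℝ, k < K →
      (∀ i, p k ≤ i → i ≤ p (k + 1) → ∀ x, (E i f x - E (p k) f x) ^ 2 ≤ D x) ∧
      ∑ x ∈ Finset.range (2 ^ N), D x ≤ 10 * (∑ x ∈ Finset.range (2 ^ N), (E (p k) f x) ^ 2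
        - ∑ x ∈ Finset.range (2 ^ N), (E (p (k + 1)) f x) ^ 2) := by
    intro k
    by_cases hk : k < K
    · obtain ⟨D, h⟩ := osc (hps k).le (hpN (k + 1) (by omega)) f
      exact ⟨D, fun _ => h⟩
    · exact ⟨0, fun h => absurd h hk⟩
  choose D hD using hD
  have Dsum : ∑ k ∈ Finset.range K, ∑ x ∈ Finset.range (2 ^ N), D k x ≤ 10 * F := by
    refine (Finset.sum_le_sum fun k hk => (hD k (Finset.mem_range.1 hk)).2).trans ?_
    rw [← Finset.mul_sum,
      Finset.sum_range_sub' (fun k => ∑ x ∈ Finset.range (2 ^ N), (E (p k) f x) ^ 2)]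
    have a1 : 0 ≤ ∑ x ∈ Finset.range (2 ^ N), (E (p K) f x) ^ 2 :=
      Finset.sum_nonneg fun _ _ => sq_nonneg _
    have a2 := E_pyth (Nat.zero_le (p 0)) (hpN 0 (by omega)) f
    have a3 : 0 ≤ ∑ x ∈ Finset.range (2 ^ N), (E 0 f x - E (p 0) f x) ^ 2 :=
      Finset.sum_nonneg fun _ _ => sq_nonneg _
    rw [a2, E_zero] at a3
    linarith
  set R : ℕ → ℕ → ℝ := fun k x =>
    ∑ m ∈ Finset.Ico (n k) (n (k + 1)), (A (m + 1) f x / m) ^ 2 with hR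
  have Rsum : ∑ k ∈ Finset.range K, ∑ x ∈ Finset.range (2 ^ N), R k x ≤ 2 * F := by
    have e : ∀ k ∈ Finset.range K, ∑ x ∈ Finset.range (2 ^ N), R k x
        = ∑ m ∈ Finset.Ico (n k) (n (k + 1)),
            ∑ x ∈ Finset.range (2 ^ N), (A (m + 1) f x / m) ^ 2 :=
      fun k _ => Finset.sum_comm
    rw [Finset.sum_congr rfl e, sum_consec n hnm]
    have b : ∀ m ∈ Finset.Ico (n 0) (n K),
        ∑ x ∈ Finset.range (2 ^ N), (A (m + 1) f x / m) ^ 2 ≤ ((m : ℝ) ^ 2)⁻¹ * F := by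
      intro m _
      simp only [div_eq_inv_mul, mul_pow, inv_pow]
      rw [← Finset.mul_sum]
      have := A_norm (Nat.succ_pos m) f hf
      exact mul_le_mul_of_nonneg_left this (by positivity)
    refine (Finset.sum_le_sum b).trans ?_
    rw [← Finset.sum_mul]
    have c := sum_Ioo_inv_sq_le (α := ℝ) 0 (n K)
    have c2 : ∑ m ∈ Finset.Ico (n 0) (n K), ((m : ℝ) ^ 2)⁻¹
        ≤ ∑ m ∈ Finset.Ioo 0 (n K), ((m : ℝ) ^ 2)⁻¹ := by
      refine Finset.sum_le_sum_of_subset_of_nonneg ?_ fun _ _ _ => by positivity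
      intro i hi
      have := Finset.mem_Ico.1 hi
      have := h2 0
      exact Finset.mem_Ioo.2 (by omega)
    norm_num at c
    exact mul_le_mul_of_nonneg_right (by linarith) hF0
  refine ⟨fun k x => 5 * (2 * S k x + S (k + 1) x + D k x + 2 * R k x), ?_, ?_⟩
  · intro k hk m hm x
    have hm := Finset.mem_Ico.1 hm
    have hnk := h2 k
    obtain ⟨i, hi⟩ : ∃ i, i = Nat.log 2 (m + 1) := ⟨_, rfl⟩
    have i1 : p k ≤ i := by rw [hi]; exact Nat.log_mono_right (by omega)
    have i2 : i ≤ p (k + 1) := by rw [hi]; exact Nat.log_mono_right (by omega)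
    have iN : i ≤ N := i2.trans (hpN _ (by omega))
    have t1 := Hpt i (m + 1) x iN (by rw [hi]; exact Nat.pow_log_le_self 2 (by omega))
      (by rw [hi]; exact Nat.lt_pow_succ_log_self (by norm_num) _)
    have t2 := (hD k hk).1 i i1 i2 x
    have t3 := Hpt (p k) (n k + 1) x (i1.trans iN) (Nat.pow_log_le_self 2 (by omega))
      (Nat.lt_pow_succ_log_self (by norm_num) _)
    have t4 : (A (m + 1) f x / m) ^ 2 ≤ R k x :=
      Finset.single_le_sum (f := fun m : ℕ => (A (m + 1) f x / m) ^ 2) (fun _ _ => sq_nonneg _)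
        (Finset.mem_Ico.2 hm)
    have t5 : (A (n k + 1) f x / n k) ^ 2 ≤ R k x :=
      Finset.single_le_sum (f := fun m : ℕ => (A (m + 1) f x / m) ^ 2) (fun _ _ => sq_nonneg _)
        (Finset.mem_Ico.2 ⟨le_rfl, by omega⟩)
    have s1 := HS2 k i x i1 i2
    have s3 := HS k (p k) x le_rfl (hps k)
    have e : M m f x - M (n k) f x = (A (m + 1) f x - E i f x) + (E i f x - E (p k) f x)
        + (-(A (n k + 1) f x - E (p k) f x)) + A (m + 1) f x / m + (-(A (n k + 1) f x / n k)) := by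
      rw [M_eq (by omega), M_eq (by omega)]; ring
    rw [e]
    refine (five _ _ _ _ _).trans ?_
    rw [neg_sq, neg_sq]
    linarith
  · simp only [← Finset.mul_sum, Finset.sum_add_distrib]
    linarith

end White

/-- (H. White's discretized variational inequality.) There is an absolute constant `C`
such that for every real sequence `(a_j)` with `|a_j| ≤ 1` and every strictly increasing
sequence of positive integers `(n_k)` with `n_{k+1} > n_k^8`, setting
`M_n(a)(j) = (1/n) ∑_{l=0}^{n} a_{l+j}`, one has for all `J, K`:
`∑_{j=1}^J ∑_{k=1}^K |sup_{n_k ≤ n < n_{k+1}} M_n(a)(j) − M_{n_k}(a)(j)|²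
  ≤ C ∑_{j=1}^{J + n_{K+1}} |a_j|²`. -/
theorem white_variational_inequality :
    ∃ C : ℝ, 0 < C ∧
      ∀ (a : ℕ → ℝ), (∀ j, |a j| ≤ 1) →
      ∀ (n : ℕ → ℕ), (∀ k, 0 < n k) →
      ∀ (hlt : ∀ k, n k < n (k + 1)), (∀ k, (n k) ^ 8 < n (k + 1)) →
      ∀ J K : ℕ,
        ∑ j ∈ Finset.Icc 1 J, ∑ k ∈ Finset.Icc 1 K,
          |(Finset.Ico (n k) (n (k + 1))).sup' (Finset.nonempty_Ico.mpr (hlt k))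
              (fun m => (1 / (m : ℝ)) * ∑ l ∈ Finset.range (m + 1), a (l + j)) -
            (1 / (n k : ℝ)) * ∑ l ∈ Finset.range (n k + 1), a (l + j)| ^ 2
        ≤ C * ∑ j ∈ Finset.Icc 1 (J + n (K + 1)), |a j| ^ 2 := by
  refine ⟨12000, by norm_num, ?_⟩
  intro a _ n hpos hlt h8 J K
  set n' : ℕ → ℕ := fun k => n (1 + k) with hn'
  have hmono : Monotone n := monotone_nat_of_le_succ fun k => (hlt k).le
  have h2 : ∀ k, 2 ≤ n' k := by
    intro k
    have h1 := hpos 0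
    have h3 := hlt 0
    have h4 : n (0 + 1) ≤ n (1 + k) := hmono (by omega)
    simp only [hn']
    omega
  obtain ⟨N, hN⟩ : ∃ N, N = Nat.log 2 (n' (K + 1) + 1) + J + n (K + 1) + 1 := ⟨_, rfl⟩
  have hNN : N < 2 ^ N := Nat.lt_two_pow_self
  set f : ℕ → ℝ := fun x => if x ∈ Finset.Icc 1 (J + n (K + 1)) then a x else 0 with hf
  have hfz : ∀ x, 2 ^ N ≤ x → f x = 0 := by
    intro x hx
    simp only [hf]
    rw [if_neg]
    rw [Finset.mem_Icc]
    omega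
  obtain ⟨V, hV, hVs⟩ := White.core n' h2 (fun k => h8 (1 + k)) K N (by omega) f hfz
  have hV0 : ∀ k, k < K → ∀ x, 0 ≤ V k x := fun k hk x =>
    (sq_nonneg _).trans (hV k hk (n' k) (Finset.mem_Ico.2 ⟨le_rfl, hlt (1 + k)⟩) x)
  have hMf : ∀ j ∈ Finset.Icc 1 J, ∀ m, m < n (K + 1) →
      (1 / (m : ℝ)) * ∑ l ∈ Finset.range (m + 1), a (l + j) = White.M m f j := by
    intro j hj m hm
    have hj := Finset.mem_Icc.1 hj
    unfold White.M
    congr 1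
    refine Finset.sum_congr rfl fun l hl => ?_
    have hl := Finset.mem_range.1 hl
    simp only [hf]
    rw [if_pos (Finset.mem_Icc.2 (by omega))]
  have hIcc : Finset.Icc 1 K = Finset.Ico 1 (K + 1) := by
    ext x; simp only [Finset.mem_Icc, Finset.mem_Ico]; omega
  have hpt : ∀ j ∈ Finset.Icc 1 J, ∑ k ∈ Finset.Icc 1 K,
          |(Finset.Ico (n k) (n (k + 1))).sup' (Finset.nonempty_Ico.mpr (hlt k))
              (fun m => (1 / (m : ℝ)) * ∑ l ∈ Finset.range (m + 1), a (l + j)) -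
            (1 / (n k : ℝ)) * ∑ l ∈ Finset.range (n k + 1), a (l + j)| ^ 2
      ≤ ∑ k ∈ Finset.range K, V k j := by
    intro j hj
    rw [hIcc, Finset.sum_Ico_eq_sum_range, Nat.add_sub_cancel]
    refine Finset.sum_le_sum fun k hk => ?_
    have hk := Finset.mem_range.1 hk
    obtain ⟨m, hm, hme⟩ := Finset.exists_mem_eq_sup' (Finset.nonempty_Ico.mpr (hlt (1 + k)))
      (fun m : ℕ => (1 / (m : ℝ)) * ∑ l ∈ Finset.range (m + 1), a (l + j))
    have hm' := Finset.mem_Ico.1 hm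
    have hle : n (1 + k + 1) ≤ n (K + 1) := hmono (by omega)
    rw [hme, sq_abs, hMf j hj m (by omega), hMf j hj (n (1 + k)) (by omega)]
    exact hV k hk m hm j
  refine (Finset.sum_le_sum hpt).trans ?_
  rw [Finset.sum_comm]
  have hsub : ∀ k ∈ Finset.range K, ∑ j ∈ Finset.Icc 1 J, V k j
      ≤ ∑ x ∈ Finset.range (2 ^ N), V k x := by
    intro k hk
    refine Finset.sum_le_sum_of_subset_of_nonneg ?_ fun x _ _ => hV0 k (Finset.mem_range.1 hk) x
    intro x hx
    have := Finset.mem_Icc.1 hx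
    exact Finset.mem_range.2 (by omega)
  refine (Finset.sum_le_sum hsub).trans (hVs.trans ?_)
  refine mul_le_mul_of_nonneg_left ?_ (by norm_num)
  have e : ∀ x ∈ Finset.range (2 ^ N), (f x) ^ 2
      = if x ∈ Finset.Icc 1 (J + n (K + 1)) then |a x| ^ 2 else 0 := by
    intro x _
    simp only [hf]
    split_ifs
    · rw [sq_abs]
    · simp
  rw [Finset.sum_congr rfl e, Finset.sum_ite_mem]
  exact Finset.sum_le_sum_of_subset_of_nonneg Finset.inter_subset_right fun _ _ _ => by positivity
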